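/- arXiv:1810.04777 — 2 statements merged into one kernel-verified Lean document; each statement's English description precedes it below -/
import Mathlib

section
/- Unbiasedness of the Rao-Blackwellized estimator: suppose ε := μ(Cᶜ) > 0 and g is μ-integrable. Then the expectation of ĝ under the conditional measure μ|Cᶜ equals the expectation of g under μ, i.e. ∫ ĝ(v) d(μ|Cᶜ)(v) = ∫ g dμ. -/
open MeasureTheory ProbabilityTheory

/-- Unbiasedness of the Rao-Blackwellized estimator: if `ε := μ(Cᶜ) > 0` and `g` is
`μ`-integrable, then `∫ ĝ(v) d(μ|Cᶜ)(v) = ∫ g dμ`, where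
`ĝ(v) = ∫_C g dμ + ε * g(v)`. -/
theorem rb_unbiased {Z : Type*} [MeasurableSpace Z] (μ : Measure Z) [IsProbabilityMeasure μ]
    (g : Z → ℝ) (C : Set Z) (hC : MeasurableSet C)
    (ε : ℝ) (hεdef : ε = (μ Cᶜ).toReal) (hε : 0 < ε)
    (hg : Integrable g μ) :
    ∫ v, ((∫ z in C, g z ∂μ) + ε * g v) ∂(μ[|Cᶜ]) = ∫ z, g z ∂μ := by
  have hpos : μ Cᶜ ≠ 0 := fun h => by simp [hεdef, h] at hε
  have : IsProbabilityMeasure (μ[|Cᶜ]) := cond_isProbabilityMeasure hpos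
  have hint : Integrable g (μ[|Cᶜ]) :=
    hg.restrict.smul_measure (ENNReal.inv_ne_top.mpr hpos)
  have hcond : ∫ v, g v ∂(μ[|Cᶜ]) = ε⁻¹ * ∫ v in Cᶜ, g v ∂μ := by
    rw [ProbabilityTheory.cond, integral_smul_measure, ENNReal.toReal_inv, ← hεdef, smul_eq_mul]
  rw [integral_add (integrable_const _) (hint.const_mul ε), integral_const, probReal_univ,
    one_smul, integral_const_mul, hcond, mul_inv_cancel_left₀ hε.ne', integral_add_compl hC hg]
end

section
/- Unbiasedness of the REINFORCE⁺ estimator (leave-one-out control variate): the double sum over independent draws z, z' of the REINFORCE estimator with control variate f(η₀)(z') equals the gradient of the objective, i.e. Σ_{z ∈ Z} Σ_{z' ∈ Z} q(η₀)(z)·q(η₀)(z') • ( (f(η₀)(z) − f(η₀)(z')) • D(log q)(z) + Df(z) ) equals the Fréchet derivative at η₀ of η ↦ Σ_{z ∈ Z} q(η)(z)·f(η)(z), where D(log q)(z) is the Fréchet derivative at η₀ of η ↦ log q(η)(z) and Df(z) is the Fréchet derivative at η₀ of η ↦ f(η)(z). -/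
/-- Unbiasedness of the REINFORCE⁺ estimator (leave-one-out control variate):
`∑ z, ∑ z', q(η₀)(z) * q(η₀)(z') • ( (f(η₀)(z) - f(η₀)(z')) • D(log q)(z) + Df(z) )`
equals the Fréchet derivative at `η₀` of `η ↦ ∑ z, q(η)(z) * f(η)(z)`. -/
theorem reinforce_plus_unbiased {Z : Type*} [Fintype Z] {E : Type*}
    [NormedAddCommGroup E] [NormedSpace ℝ E] (η₀ : E) (q : E → Z → ℝ) (f : E → Z → ℝ)
    (hq_pos : ∀ η z, 0 < q η z)
    (hq_sum : ∀ η, ∑ z, q η z = 1)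
    (hq_diff : ∀ z, ∀ η : E, DifferentiableAt ℝ (fun η' => q η' z) η)
    (hf_diff : ∀ z, DifferentiableAt ℝ (fun η' => f η' z) η₀) :
    ∑ z, ∑ z', (q η₀ z * q η₀ z')
        • ((f η₀ z - f η₀ z') • fderiv ℝ (fun η => Real.log (q η z)) η₀
            + fderiv ℝ (fun η => f η z) η₀)
      = fderiv ℝ (fun η => ∑ z, q η z * f η z) η₀ := by
  have score_sum : ∑ z, fderiv ℝ (fun η => q η z) η₀ = 0 := by
    rw [← fderiv_fun_sum fun z _ => hq_diff z η₀]
    simp [hq_sum]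
  have objective : fderiv ℝ (fun η => ∑ z, q η z * f η z) η₀
      = ∑ z, (q η₀ z • fderiv ℝ (fun η => f η z) η₀
        + f η₀ z • fderiv ℝ (fun η => q η z) η₀) := by
    rw [fderiv_fun_sum fun z _ => (hq_diff z η₀).fun_mul (hf_diff z)]
    exact Finset.sum_congr rfl fun z _ => fderiv_fun_mul (hq_diff z η₀) (hf_diff z)
  have summand (z z' : Z) : (q η₀ z * q η₀ z')
      • ((f η₀ z - f η₀ z') • fderiv ℝ (fun η => Real.log (q η z)) η₀
        + fderiv ℝ (fun η => f η z) η₀)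
      = q η₀ z' • (q η₀ z • fderiv ℝ (fun η => f η z) η₀
        + f η₀ z • fderiv ℝ (fun η => q η z) η₀)
        - (q η₀ z' * f η₀ z') • fderiv ℝ (fun η => q η z) η₀ := by
    have hz : q η₀ z ≠ 0 := (hq_pos η₀ z).ne'
    rw [fderiv.log (hq_diff z η₀) hz]
    match_scalars <;> field_simp
  simp_rw [summand, Finset.sum_sub_distrib, ← Finset.sum_smul, hq_sum, one_smul,
    ← Finset.smul_sum, score_sum, smul_zero, sub_zero, objective]
end
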